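/- If G is a non-locally compact paratopological group and Y = bG \ G is a remainder of G that is metacompact and ccc, then Y is Lindelöf. -/

import Mathlib

open Set

/-- A space is ccc if every pairwise disjoint family of nonempty open sets is countable. -/
def CCC (X : Type*) [TopologicalSpace X] : Prop :=
  ∀ S : Set (Set X), (∀ U ∈ S, IsOpen U ∧ U.Nonempty) → S.PairwiseDisjoint id → S.Countable

/-- A space is metacompact if every open cover has a point-finite open refinement which
is still a cover. -/
def Metacompact (X : Type*) [TopologicalSpace X] : Prop :=
  ∀ 𝒰 : Set (Set X), (∀ U ∈ 𝒰, IsOpen U) → ⋃₀ 𝒰 = univ →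
    ∃ 𝒱 : Set (Set X), (∀ V ∈ 𝒱, IsOpen V) ∧ ⋃₀ 𝒱 = univ ∧
      (∀ V ∈ 𝒱, ∃ U ∈ 𝒰, V ⊆ U) ∧ (∀ x : X, {V ∈ 𝒱 | x ∈ V}.Finite)

/-- A nonempty compact set of countable character in `G` forces the remainder to be Lindelöf. -/
lemma aux_lindelof {G B : Type*} [TopologicalSpace G] [Group G] [ContinuousMul G]
    [TopologicalSpace B] [CompactSpace B] [T2Space B]
    (e : G → B) (he : Topology.IsEmbedding e) (hd : DenseRange e)
    (P : ℕ → Set B) (hPo : ∀ n, IsOpen (P n)) (hPn : ∀ n, (P n).Nonempty)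
    (hPc : ∀ n, closure (P (n+1)) ⊆ P n) (hPr : (⋂ n, P n) ⊆ range e) :
    IsLindelof ((range e)ᶜ : Set B) := by
  have hanti : Antitone P := antitone_nat_of_succ_le fun n => subset_closure.trans (hPc n)
  have hKeq : (⋂ n, P n) = ⋂ n, closure (P n) := by
    apply subset_antisymm
    · exact iInter_mono fun n => subset_closure
    · exact subset_iInter fun n => (iInter_subset _ (n+1)).trans (hPc n)
  have hantic : Antitone fun n => closure (P n) := fun a b h => closure_mono (hanti h)
  have hKc : IsCompact (⋂ n, P n) := by
    rw [hKeq]; exact (isClosed_iInter fun n => isClosed_closure).isCompact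
  have hKne : (⋂ n, P n).Nonempty := by
    rw [hKeq]
    exact IsCompact.nonempty_iInter_of_directed_nonempty_isCompact_isClosed _
      hantic.directed_ge (fun n => (hPn n).closure) (fun n => isClosed_closure.isCompact)
      (fun n => isClosed_closure)
  set K : Set G := e ⁻¹' (⋂ n, P n) with hK
  have hKGc : IsCompact K := he.isInducing.isCompact_preimage' hKc hPr
  obtain ⟨k, hk⟩ : K.Nonempty := by
    obtain ⟨x, hx⟩ := hKne
    obtain ⟨g, rfl⟩ := hPr hx
    exact ⟨g, hx⟩
  have hbase : ∀ v : Set G, IsOpen v → K ⊆ v → ∃ n, e ⁻¹' (P n) ⊆ v := by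
    intro v hv hKv
    obtain ⟨w, hw, rfl⟩ := he.isInducing.isOpen_iff.1 hv
    have : (⋂ n, closure (P n)) ⊆ w := by
      rw [← hKeq]
      intro x hx
      obtain ⟨g, rfl⟩ := hPr hx
      exact hKv hx
    obtain ⟨n, hn⟩ := exists_subset_nhds_of_isCompact' hantic.directed_ge
      (fun n => isClosed_closure.isCompact) (fun n => isClosed_closure)
      (fun x hx => hw.mem_nhds (this hx))
    exact ⟨n, preimage_mono (subset_closure.trans hn)⟩
  apply isLindelof_of_countable_subcover
  intro ι U hU hYU
  set C : Set B := (⋃ i, U i)ᶜ with hC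
  have hCr : C ⊆ range e := by
    rw [hC, compl_subset_comm]; exact hYU
  have hCc : IsCompact C := (isOpen_iUnion hU).isClosed_compl.isCompact
  set D : Set G := (fun g => g * k⁻¹) '' (e ⁻¹' C) with hD
  have hDc : IsCompact D :=
    (he.isInducing.isCompact_preimage' hCc hCr).image (continuous_mul_const _)
  have hDopen : ∀ n, IsOpen {x : G | ∃ d ∈ D, ∃ v, e v ∈ P n ∧ d * v = x} := by
    intro n
    have : {x : G | ∃ d ∈ D, ∃ v, e v ∈ P n ∧ d * v = x}
        = ⋃ d ∈ D, (fun v => d * v) '' (e ⁻¹' (P n)) := by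
      ext x; simp only [mem_iUnion, mem_image, mem_preimage, exists_prop, mem_ofPred_eq]
    rw [this]
    exact isOpen_biUnion fun d _ =>
      (Homeomorph.mulLeft d).isOpenMap _ ((hPo n).preimage he.continuous)
  choose Q hQo hQ using fun n => he.isInducing.isOpen_iff.1 (hDopen n)
  have hQmem : ∀ n g, e g ∈ Q n ↔ ∃ d ∈ D, ∃ v, e v ∈ P n ∧ d * v = g := by
    intro n g
    have := Set.ext_iff.1 (hQ n) g
    exact this
  have hCQ : ∀ n, C ⊆ Q n := by
    intro n x hx
    obtain ⟨g, rfl⟩ := hCr hx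
    exact (hQmem n g).2 ⟨g * k⁻¹, ⟨g, hx, rfl⟩, k, mem_iInter.1 hk n, by simp⟩
  have hQY : ∀ y ∈ (range e)ᶜ, ∃ n, y ∉ Q n := by
    intro y hy
    have hDK : IsCompact ((fun p : G × G => e (p.1 * p.2)) '' (D ×ˢ K)) :=
      (hDc.prod hKGc).image (he.continuous.comp continuous_mul)
    have hdis : Disjoint ((fun p : G × G => e (p.1 * p.2)) '' (D ×ˢ K)) {y} := by
      rw [disjoint_singleton_right]
      rintro ⟨p, -, hp⟩
      exact hy ⟨_, hp⟩
    obtain ⟨O1, O2, hO1, hO2, h1, h2, h12⟩ :=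
      SeparatedNhds.of_isCompact_isCompact hDK isCompact_singleton hdis
    obtain ⟨u, v, hu, hv, hDu, hKv, huv⟩ := generalized_tube_lemma hDc hKGc
      (n := (fun p : G × G => e (p.1 * p.2)) ⁻¹' O1)
      (hO1.preimage (he.continuous.comp continuous_mul)) (image_subset_iff.1 h1)
    obtain ⟨n, hn⟩ := hbase v hv hKv
    refine ⟨n, fun hyQ => ?_⟩
    obtain ⟨x, ⟨hxQ, hx2⟩, g, rfl⟩ := hd.inter_open_nonempty (Q n ∩ O2) ((hQo n).inter hO2)
      ⟨y, hyQ, h2 rfl⟩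
    obtain ⟨d, hdD, w, hw, rfl⟩ := (hQmem n g).1 hxQ
    exact disjoint_left.1 h12 (huv (mk_mem_prod (hDu hdD) (hn hw))) hx2
  have hfin : ∀ n, ∃ t : Finset ι, (Q n)ᶜ ⊆ ⋃ i ∈ t, U i := by
    intro n
    apply (hQo n).isClosed_compl.isCompact.elim_finite_subcover U hU
    rw [compl_subset_comm]
    exact hCQ n
  choose t ht using hfin
  refine ⟨⋃ n, (t n : Set ι), countable_iUnion fun n => (t n).countable_toSet, ?_⟩
  intro y hy
  obtain ⟨n, hn⟩ := hQY y hy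
  obtain ⟨i, hi, hyi⟩ := mem_iUnion₂.1 (ht n hn)
  exact mem_iUnion₂.2 ⟨i, mem_iUnion.2 ⟨n, hi⟩, hyi⟩

/-- The remainder of a non-locally compact paratopological group is dense. -/
lemma aux_dense {G B : Type*} [TopologicalSpace G] [Group G] [ContinuousMul G]
    [TopologicalSpace B] [CompactSpace B] [T2Space B]
    (hnlc : ¬ LocallyCompactSpace G)
    (e : G → B) (he : Topology.IsEmbedding e) (hd : DenseRange e)
    (O : Set B) (hO : IsOpen O) (hne : O.Nonempty) : (O ∩ (range e)ᶜ).Nonempty := by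
  by_contra hcon
  have hsub : O ⊆ range e := by
    intro x hx
    by_contra h
    exact hcon ⟨x, hx, h⟩
  apply hnlc
  have : T2Space G := he.t2Space
  obtain ⟨x, hx, g, rfl⟩ := hd.inter_open_nonempty O hO hne
  obtain ⟨N, hN, hNO, hNc⟩ := local_compact_nhds (hO.mem_nhds hx)
  have hc : IsCompact (e ⁻¹' N) := he.isInducing.isCompact_preimage' hNc (hNO.trans hsub)
  have hn : e ⁻¹' N ∈ nhds g := he.continuous.continuousAt hN
  have : WeaklyLocallyCompactSpace G := by
    constructor
    intro x
    refine ⟨Homeomorph.mulLeft (x * g⁻¹) '' (e ⁻¹' N), hc.image (Homeomorph.continuous _), ?_⟩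
    have := (Homeomorph.mulLeft (x * g⁻¹)).isOpenMap.image_mem_nhds hn
    simpa using this
  infer_instance

/-- In a ccc space, if every nonempty open set contains a nonempty open set meeting only finitely
many members of an open family, then the family is countable. -/
lemma aux_countable {Y : Type*} [TopologicalSpace Y] (hc : CCC Y) (𝒱 : Set (Set Y))
    (ho : ∀ V ∈ 𝒱, IsOpen V)
    (hg : ∀ W : Set Y, IsOpen W → W.Nonempty → ∃ W' ⊆ W, IsOpen W' ∧ W'.Nonempty ∧
      {V ∈ 𝒱 | (V ∩ W').Nonempty}.Finite) : 𝒱.Countable := by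
  let F : Set (Set (Set Y)) := {S | (∀ W ∈ S, IsOpen W ∧ W.Nonempty ∧
      {V ∈ 𝒱 | (V ∩ W).Nonempty}.Finite) ∧ S.PairwiseDisjoint id}
  obtain ⟨S, hS⟩ : ∃ S, Maximal (· ∈ F) S := by
    apply zorn_subset
    intro c hcF hchain
    refine ⟨⋃₀ c, ⟨?_, ?_⟩, fun s hs => subset_sUnion_of_mem hs⟩
    · rintro W ⟨s, hs, hW⟩
      exact (hcF hs).1 W hW
    · rw [pairwiseDisjoint_sUnion hchain.directedOn]
      exact fun s hs => (hcF hs).2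
  have hScount : S.Countable :=
    hc S (fun W hW => ⟨(hS.prop.1 W hW).1, (hS.prop.1 W hW).2.1⟩) hS.prop.2
  have hsub : 𝒱 ⊆ {∅} ∪ ⋃ W ∈ S, {V ∈ 𝒱 | (V ∩ W).Nonempty} := by
    intro V hV
    rcases V.eq_empty_or_nonempty with h | h
    · exact Or.inl h
    right
    by_contra hcon
    simp only [mem_iUnion, mem_ofPred_eq, not_exists, not_and] at hcon
    have hdis : ∀ W ∈ S, ¬ (V ∩ W).Nonempty := fun W hW => hcon W hW hV
    obtain ⟨W', hW'V, hW'o, hW'n, hW'f⟩ := hg V (ho V hV) h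
    have hins : insert W' S ∈ F := by
      refine ⟨?_, ?_⟩
      · rintro W (rfl | hW)
        · exact ⟨hW'o, hW'n, hW'f⟩
        · exact hS.prop.1 W hW
      · apply hS.prop.2.insert
        intro W hW _
        rw [id, id, disjoint_left]
        intro x hx hx'
        exact hdis W hW ⟨x, hW'V hx, hx'⟩
    have : W' ∈ S := hS.le_of_ge hins (subset_insert _ _) (mem_insert _ _)
    obtain ⟨x, hx⟩ := hW'n
    exact hdis W' this ⟨x, hW'V hx, hx⟩
  refine Countable.mono hsub ((countable_singleton _).union ?_)
  exact hScount.biUnion fun W hW => (hS.prop.1 W hW).2.2.countable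

/-- if `G` is a non-locally compact paratopological group and the remainder
`Y = bG \ G` is metacompact and ccc, then `Y` is Lindelöf. -/
theorem stmt7 {G B : Type*} [TopologicalSpace G] [T35Space G] [Group G] [ContinuousMul G]
    [TopologicalSpace B] [CompactSpace B] [T2Space B]
    (hnlc : ¬ LocallyCompactSpace G)
    (e : G → B) (he : Topology.IsEmbedding e) (hd : DenseRange e)
    (hm : Metacompact ((Set.range e)ᶜ : Set B)) (hc : CCC ((Set.range e)ᶜ : Set B)) :
    LindelofSpace ((Set.range e)ᶜ : Set B) := by
  rw [← isLindelof_iff_lindelofSpace]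
  by_contra hnL
  apply hnL
  apply isLindelof_of_countable_subcover
  intro ι U hU hYU
  obtain ⟨𝒱, hVo, hVc, hVr, hVf⟩ := hm (range fun i => (Subtype.val ⁻¹' (U i)))
    (by rintro _ ⟨i, rfl⟩; exact (hU i).preimage continuous_subtype_val)
    (by
      rw [eq_univ_iff_forall]
      intro y
      obtain ⟨i, hi⟩ := mem_iUnion.1 (hYU y.2)
      exact ⟨_, ⟨i, rfl⟩, hi⟩)
  have hcount : 𝒱.Countable := by
    apply aux_countable hc 𝒱 hVo
    by_contra hcon
    push Not at hcon
    obtain ⟨W, hWo, hWn, hW⟩ := hcon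
    obtain ⟨O, hO, rfl⟩ := isOpen_induced_iff.1 hWo
    apply hnL
    -- invariant: nonempty open subset of `O` whose trace lies in `n` members
    let I : ℕ → Set B → Prop := fun n P => IsOpen P ∧ P.Nonempty ∧ P ⊆ O ∧
      ∃ S : Finset (Set ((Set.range e)ᶜ : Set B)), S.card = n ∧
        ∀ V ∈ S, V ∈ 𝒱 ∧ ∀ y : ((Set.range e)ᶜ : Set B), y.1 ∈ P → y ∈ V
    have step : ∀ n P, I n P → ∃ P', I (n+1) P' ∧ closure P' ⊆ P := by
      rintro n P ⟨hPo, hPn, hPO, S, hSn, hS⟩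
      obtain ⟨z, hzP, hzY⟩ := aux_dense hnlc e he hd P hPo hPn
      have hinf := hW (Subtype.val ⁻¹' P) (preimage_mono hPO)
        (hPo.preimage continuous_subtype_val) ⟨⟨z, hzY⟩, hzP⟩
      obtain ⟨V, ⟨hV, y, hyV, hyP⟩, hVS⟩ := Set.Infinite.exists_notMem_finset hinf S
      obtain ⟨V', hV'o, rfl⟩ := isOpen_induced_iff.1 (hVo V hV)
      obtain ⟨N, hyN, hNo, hN⟩ : ∃ N : Set B, (y : B) ∈ N ∧ IsOpen N ∧ closure N ⊆ P ∩ V' := by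
        obtain ⟨t, hty, htc, hts⟩ := exists_mem_nhds_isClosed_subset
          ((hPo.inter hV'o).mem_nhds (show (y : B) ∈ P ∩ V' from ⟨hyP, hyV⟩))
        exact ⟨interior t, mem_interior_iff_mem_nhds.2 hty, isOpen_interior,
          (closure_minimal interior_subset htc).trans hts⟩
      have hNP : N ⊆ P ∩ V' := subset_closure.trans hN
      classical
      refine ⟨N, ⟨hNo, ⟨y, hyN⟩, fun x hx => hPO (hNP hx).1, insert (Subtype.val ⁻¹' V') S, ?_, ?_⟩,
        hN.trans inter_subset_left⟩
      · rw [Finset.card_insert_of_notMem hVS, hSn]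
      · intro V hVi
        rcases Finset.mem_insert.1 hVi with rfl | h
        · exact ⟨hV, fun y hy => (hNP hy).2⟩
        · exact ⟨(hS V h).1, fun y hy => (hS V h).2 y (hNP hy).1⟩
    have h0 : I 0 O := ⟨hO, by obtain ⟨y, hy⟩ := hWn; exact ⟨y, hy⟩, subset_rfl, ∅, by simp⟩
    choose! f hf1 hf2 using step
    let P : ℕ → Set B := fun n => Nat.rec O (fun n P => f n P) n
    have hP : ∀ n, I n (P n) := by
      intro n
      induction n with
      | zero => exact h0
      | succ n ih => exact hf1 n _ ih
    refine aux_lindelof e he hd P (fun n => (hP n).1) (fun n => (hP n).2.1)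
      (fun n => hf2 n _ (hP n)) ?_
    intro x hx
    by_contra hxr
    have hfin := hVf ⟨x, hxr⟩
    obtain ⟨S, hSn, hS⟩ := (hP (hfin.toFinset.card + 1)).2.2.2
    have : S ⊆ hfin.toFinset := by
      intro V hV
      rw [Finite.mem_toFinset]
      exact ⟨(hS V hV).1, (hS V hV).2 ⟨x, hxr⟩ (mem_iInter.1 hx (hfin.toFinset.card + 1))⟩
    have := Finset.card_le_card this
    omega
  choose i hi using fun V : 𝒱 => (show ∃ i, V.1 ⊆ Subtype.val ⁻¹' (U i) by
    obtain ⟨_, ⟨i, rfl⟩, h⟩ := hVr V.1 V.2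
    exact ⟨i, h⟩)
  have : Countable 𝒱 := hcount.to_subtype
  refine ⟨range i, countable_range i, fun y hy => ?_⟩
  obtain ⟨V, hV, hyV⟩ : (⟨y, hy⟩ : ((Set.range e)ᶜ : Set B)) ∈ ⋃₀ 𝒱 := hVc ▸ mem_univ _
  exact mem_iUnion₂.2 ⟨i ⟨V, hV⟩, mem_range_self _, hi ⟨V, hV⟩ hyV⟩
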